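/- Let n ∈ ℕ, let (M, f, s, mx, le, zero) be an interpretation satisfying the NiA clause set C(n), and let b : {0, …, n} → {0, …, n} be a bijection. Then for all k, j with 0 ≤ k ≤ j ≤ n and every assignment x : ℕ → M: if f (x (i+1)) = num (b i) for all i ≤ k, then there exists i with k < i ≤ j and f (m k x (s (x (k+1)))) = num (b i). (Semantic content of: the clause c'_b(k, j) is derivable by resolution from C(n) for all 0 ≤ k ≤ j ≤ n.) -/

import Mathlib

/-- Numerals in the interpretation: `num 0 = zero`, `num (k+1) = s (num k)`. -/
def num {M : Type*} (s : M → M) (zero : M) : ℕ → M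
  | 0 => zero
  | k + 1 => s (num s zero k)

/-- The iterated max term `m(k, x̄, t)`. -/
def itm {M : Type*} (s : M → M) (mx : M → M → M) : ℕ → (ℕ → M) → M → M
  | 0, _, t => t
  | k + 1, x, t => itm s mx k x (mx (s (x (k + 1))) t)

/-- Every finite set has an element such that whatever lies above it lies above the
successors of all members of the set. -/
theorem exists_forall_le_imp_succ_le {M : Type*} (s : M → M) (mx : M → M → M)
    (le : M → M → Prop) (zero : M)
    (hleft : ∀ a b c, le (mx a b) c → le a c)
    (hright : ∀ a b c, le (mx a b) c → le b c) (S : Finset M) :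
    ∃ u, ∀ c, le u c → ∀ x ∈ S, le (s x) c := by
  classical
  induction S using Finset.induction_on with
  | empty => exact ⟨zero, by simp⟩
  | insert a S _ ih =>
    obtain ⟨u, hu⟩ := ih
    refine ⟨mx (s a) u, fun c hc x hx => ?_⟩
    rcases Finset.mem_insert.1 hx with rfl | hx
    · exact hleft _ _ _ hc
    · exact hu c (hright _ _ _ hc) x hx

/-- The NiA clause set is unsatisfiable. -/
theorem nia_unsatisfiable {M : Type*} (n : ℕ) (f s : M → M) (mx : M → M → M)
    (le : M → M → Prop) (zero : M)
    (hC1 : ∀ a, le a a)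
    (hC2 : ∀ a b c, le (mx a b) c → le a c)
    (hC3 : ∀ a b c, le (mx a b) c → le b c)
    (hC4 : ∀ k ≤ n, ∀ a b, ¬ (f b = num s zero k ∧ f a = num s zero k ∧ le (s b) a))
    (hC5 : ∀ a, ∃ i ≤ n, f a = num s zero i) : False := by
  obtain ⟨y, -, hy⟩ := exists_seq_of_forall_finset_exists (fun _ : M => True)
    (fun a b => le (s a) b) fun S _ => by
      obtain ⟨u, hu⟩ := exists_forall_le_imp_succ_le s mx le zero hC2 hC3 S
      exact ⟨u, trivial, hu u (hC1 u)⟩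
  choose g hgn hg using fun i => hC5 (y i)
  obtain ⟨i, j, hij, h⟩ := Finite.exists_ne_map_eq_of_infinite
    fun i => (⟨g i, Nat.lt_succ_of_le (hgn i)⟩ : Fin (n + 1))
  have hgij : g i = g j := congrArg Fin.val h
  rcases lt_or_gt_of_ne hij with hlt | hlt
  · exact hC4 (g i) (hgn i) (y j) (y i) ⟨hg i, hgij ▸ hg j, hy i j hlt⟩
  · exact hC4 (g i) (hgn i) (y i) (y j) ⟨hgij ▸ hg j, hg i, hy j i hlt⟩

theorem stmt11 {M : Type*} (n : ℕ) (f s : M → M) (mx : M → M → M)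
    (le : M → M → Prop) (zero : M)
    (hC1 : ∀ a, le a a)
    (hC2 : ∀ a b c, le (mx a b) c → le a c)
    (hC3 : ∀ a b c, le (mx a b) c → le b c)
    (hC4 : ∀ k ≤ n, ∀ a b, ¬ (f b = num s zero k ∧ f a = num s zero k ∧ le (s b) a))
    (hC5 : ∀ a, ∃ i ≤ n, f a = num s zero i)
    (b : ℕ → ℕ) (hb : Set.BijOn b (Set.Iic n) (Set.Iic n)) :
    ∀ k j : ℕ, k ≤ j → j ≤ n → ∀ x : ℕ → M,
      (∀ i ≤ k, f (x (i + 1)) = num s zero (b i)) →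
      ∃ i, k < i ∧ i ≤ j ∧ f (itm s mx k x (s (x (k + 1)))) = num s zero (b i) := by
  exact (nia_unsatisfiable n f s mx le zero hC1 hC2 hC3 hC4 hC5).elim
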